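/- Let w ∈ C⁴(ℝ≥0) and suppose the acceleration is bounded: |ẅ(t)| < C for all t ≥ 0, for some constant C > 0. Let φ₀ ∈ (0, π/2) be the unique root of tan(φ₀) = C. Then for every λ ∈ ℝ there exists an angle ψ ∈ (−φ₀, φ₀) such that the Whitney pendulum equation φ̈ = sin φ − ẅ(t) cos φ has a solution φ ∈ C⁴(ℝ≥0) with φ(0) = ψ, φ̇(0) = λ(φ₀² − ψ²), and |φ(t)| < φ₀ for all t ≥ 0. -/

import Mathlib

open Set Real

noncomputable section

open Filter Topology
open scoped NNReal

/-- A Lipschitz, bounded, time-dependent vector field has solutions on `[0, T]`. -/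
lemma exists_solution_Icc_of_bounded {E : Type*} [NormedAddCommGroup E] [NormedSpace ℝ E]
    [CompleteSpace E] {v : ℝ → E → E} {K L : ℝ≥0} (hlip : ∀ t, LipschitzWith K (v t))
    (hcont : ∀ x, Continuous (v · x)) (hbound : ∀ t x, ‖v t x‖ ≤ L) (x₀ : E) {T : ℝ}
    (hT : 0 ≤ T) :
    ∃ α : ℝ → E, α 0 = x₀ ∧ ∀ t ∈ Icc 0 T, HasDerivWithinAt α (v t (α t)) (Icc 0 T) t := by
  have hPL : IsPicardLindelof v (⟨0, left_mem_Icc.2 hT⟩ : Icc (0 : ℝ) T) x₀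
      (L * T.toNNReal) 0 L K :=
    { lipschitzOnWith := fun t _ => (hlip t).lipschitzOnWith
      continuousOn := fun x _ => (hcont x).continuousOn
      norm_le := fun t _ x _ => hbound t x
      mul_max_le := by simp [hT] }
  exact hPL.exists_eq_forall_mem_Icc_hasDerivWithinAt₀

/-- Two solutions of a Lipschitz ODE on `[0, T]` separate at most exponentially. -/
lemma dist_solution_le {E : Type*} [NormedAddCommGroup E] [NormedSpace ℝ E]
    {v : ℝ → E → E} {K : ℝ≥0} (hlip : ∀ t, LipschitzWith K (v t)) {T : ℝ} {α β : ℝ → E}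
    (hα : ∀ t ∈ Icc 0 T, HasDerivWithinAt α (v t (α t)) (Icc 0 T) t)
    (hβ : ∀ t ∈ Icc 0 T, HasDerivWithinAt β (v t (β t)) (Icc 0 T) t) :
    ∀ t ∈ Icc 0 T, dist (α t) (β t) ≤ dist (α 0) (β 0) * exp (K * t) := by
  have hright : ∀ γ : ℝ → E,
      (∀ t ∈ Icc 0 T, HasDerivWithinAt γ (v t (γ t)) (Icc 0 T) t) →
      ∀ t ∈ Ico 0 T, HasDerivWithinAt γ (v t (γ t)) (Ici t) t := fun γ hγ t ht =>
    (hγ t (Ico_subset_Icc_self ht)).mono_of_mem_nhdsWithin (Icc_mem_nhdsGE_of_mem ht)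
  simpa using dist_le_of_trajectories_ODE hlip (fun t ht => (hα t ht).continuousWithinAt)
    (hright α hα) (fun t ht => (hβ t ht).continuousWithinAt) (hright β hβ) le_rfl

/-- Solutions of a Lipschitz ODE on all the intervals `[0, T]` glue to a global solution. -/
lemma exists_solution_Ici {E : Type*} [NormedAddCommGroup E] [NormedSpace ℝ E]
    {v : ℝ → E → E} {K : ℝ≥0} (hlip : ∀ t, LipschitzWith K (v t)) {x₀ : E}
    (hloc : ∀ T : ℝ, 0 ≤ T → ∃ α : ℝ → E, α 0 = x₀ ∧
      ∀ t ∈ Icc 0 T, HasDerivWithinAt α (v t (α t)) (Icc 0 T) t) :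
    ∃ α : ℝ → E, α 0 = x₀ ∧ ∀ t ∈ Ici (0 : ℝ), HasDerivWithinAt α (v t (α t)) (Ici 0) t := by
  choose! β hβ₀ hβ using hloc
  have heq : ∀ S T t : ℝ, 0 ≤ t → t ≤ S → S ≤ T → β S t = β T t := by
    intro S T t ht htS hST
    have hS : 0 ≤ S := ht.trans htS
    have hT : 0 ≤ T := hS.trans hST
    have := dist_solution_le hlip (hβ S hS)
      (fun s hs => (hβ T hT s ⟨hs.1, hs.2.trans hST⟩).mono (Icc_subset_Icc_right hST))
      t ⟨ht, htS⟩
    simpa [hβ₀ S hS, hβ₀ T hT] using this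
  refine ⟨fun t => β (t + 1) t, by simp [hβ₀], fun t ht => ?_⟩
  rw [mem_Ici] at ht
  have hmem : Icc 0 (t + 1) ∈ 𝓝[Ici 0] t :=
    mem_nhdsWithin.2 ⟨Iio (t + 1), isOpen_Iio, by simp, fun s hs => ⟨hs.2, hs.1.le⟩⟩
  have hd := (hβ (t + 2) (by linarith) t ⟨ht, by linarith⟩).mono_of_mem_nhdsWithin
    (mem_of_superset hmem (Icc_subset_Icc_right (by linarith)))
  have hev : (fun s => β (s + 1) s) =ᶠ[𝓝[Ici 0] t] β (t + 2) := by
    filter_upwards [hmem] with s hs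
    exact heq _ _ _ hs.1 (by linarith) (by linarith [hs.2])
  have ht' : β (t + 1) t = β (t + 2) t := heq _ _ _ ht (by linarith) (by linarith)
  simpa only [ht'] using hd.congr_of_eventuallyEq hev ht'

/-- The vector field on phase space of the Whitney pendulum with acceleration `a`. -/
def pendulumField (a : ℝ → ℝ) (t : ℝ) (p : ℝ × ℝ) : ℝ × ℝ :=
  (p.2, sin p.1 - a t * cos p.1)

lemma abs_force_sub_le {A C : ℝ} (hA : |A| ≤ C) (x y : ℝ) :
    |(sin x - A * cos x) - (sin y - A * cos y)| ≤ (1 + C) * |x - y| := by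
  have hs : |sin x - sin y| ≤ |x - y| := abs_sin_sub_sin_le x y
  have hc : |cos x - cos y| ≤ |x - y| := abs_cos_sub_cos_le x y
  calc |(sin x - A * cos x) - (sin y - A * cos y)|
      = |(sin x - sin y) - A * (cos x - cos y)| := by ring_nf
    _ ≤ |sin x - sin y| + |A * (cos x - cos y)| := abs_sub _ _
    _ ≤ |x - y| + C * |x - y| := by
        rw [abs_mul]
        gcongr
        exact (abs_nonneg _).trans hA
    _ = (1 + C) * |x - y| := by ring

lemma abs_force_le {A C : ℝ} (hA : |A| ≤ C) (x : ℝ) : |sin x - A * cos x| ≤ 1 + C := by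
  calc |sin x - A * cos x| ≤ |sin x| + |A * cos x| := abs_sub _ _
    _ ≤ 1 + C * 1 := by
        rw [abs_mul]
        gcongr
        · exact abs_sin_le_one x
        · exact (abs_nonneg _).trans hA
        · exact abs_cos_le_one x
    _ = 1 + C := by ring

/-- Post-composing the velocity with a `1`-Lipschitz map keeps the field Lipschitz. -/
lemma lipschitzWith_pendulumField_comp {a : ℝ → ℝ} {C : ℝ≥0} (ha : ∀ t, |a t| ≤ C)
    {g : ℝ → ℝ} (hg : LipschitzWith 1 g) (t : ℝ) :
    LipschitzWith (1 + C) fun p : ℝ × ℝ => (g p.2, (pendulumField a t p).2) := by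
  refine LipschitzWith.of_dist_le_mul fun p q => ?_
  have hC : (0 : ℝ) ≤ C := C.2
  rw [Prod.dist_eq]
  refine max_le ?_ ?_
  · calc dist (g p.2) (g q.2) ≤ 1 * dist p.2 q.2 := by simpa using hg.dist_le_mul p.2 q.2
      _ ≤ (1 + C : ℝ) * dist p q := by
        gcongr
        · linarith
        · exact le_max_right _ _
      _ = _ := by simp
  · calc dist (pendulumField a t p).2 (pendulumField a t q).2
        ≤ (1 + C) * dist p.1 q.1 := abs_force_sub_le (ha t) p.1 q.1
      _ ≤ (1 + C : ℝ) * dist p q := by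
        gcongr
        exact le_max_left _ _
      _ = _ := by simp

lemma lipschitzWith_pendulumField {a : ℝ → ℝ} {C : ℝ≥0} (ha : ∀ t, |a t| ≤ C) (t : ℝ) :
    LipschitzWith (1 + C) (pendulumField a t) :=
  lipschitzWith_pendulumField_comp ha LipschitzWith.id t

/-- The Whitney pendulum with bounded acceleration has solutions on `[0, T]`. -/
lemma exists_pendulum_solution_Icc {a : ℝ → ℝ} (hac : Continuous a) {C : ℝ≥0}
    (ha : ∀ t, |a t| ≤ C) (p₀ : ℝ × ℝ) {T : ℝ} (hT : 0 ≤ T) :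
    ∃ α : ℝ → ℝ × ℝ, α 0 = p₀ ∧
      ∀ t ∈ Icc 0 T, HasDerivWithinAt α (pendulumField a t (α t)) (Icc 0 T) t := by
  have hC : (0 : ℝ) ≤ C := C.2
  obtain ⟨R, hR⟩ : ∃ R : ℝ≥0, (R : ℝ) = |p₀.2| + (1 + C) * T := ⟨⟨_, by positivity⟩, rfl⟩
  have hg : LipschitzWith 1 fun y : ℝ => max (-R : ℝ) (min R y) :=
    (LipschitzWith.id.const_min _).const_max _
  obtain ⟨α, hα₀, hα⟩ := exists_solution_Icc_of_bounded
    (v := fun t p => (max (-R : ℝ) (min R p.2), (pendulumField a t p).2)) (L := max R (1 + C))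
    (lipschitzWith_pendulumField_comp ha hg)
    (fun p => by unfold pendulumField; fun_prop)
    (fun t p => by
      rw [Prod.norm_def, NNReal.coe_max]
      refine max_le_max ?_ (by simpa [pendulumField] using abs_force_le (ha t) p.1)
      exact abs_le.2 ⟨le_max_left _ _, max_le (by linarith [R.2]) (min_le_left _ _)⟩) p₀ hT
  refine ⟨α, hα₀, fun t ht => ?_⟩
  have hvel : ∀ s ∈ Icc 0 T,
      HasDerivWithinAt (fun s => (α s).2) (pendulumField a s (α s)).2 (Icc 0 T) s :=
    fun s hs => (hα s hs).snd
  have hle : |(α t).2| ≤ R := by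
    have h := (convex_Icc (0 : ℝ) T).norm_image_sub_le_of_norm_hasDerivWithin_le hvel
      (fun s _ => abs_force_le (ha s) (α s).1) (left_mem_Icc.2 hT) ht
    simp only [hα₀, norm_eq_abs, sub_zero, abs_of_nonneg ht.1] at h
    have h' : (1 + C : ℝ) * t ≤ (1 + C) * T := by gcongr; exact ht.2
    have := abs_sub_abs_le_abs_sub (α t).2 p₀.2
    linarith
  have hfield : pendulumField a t (α t) =
      (max (-R : ℝ) (min R (α t).2), (pendulumField a t (α t)).2) := by
    simp [pendulumField, min_eq_right (abs_le.1 hle).2, max_eq_right (abs_le.1 hle).1]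
  exact hfield ▸ hα t ht

/-- The trajectory `f` exceeds `c` at some time before which it stays above `-c`. -/
def ExitsAbove (f : ℝ → ℝ) (c : ℝ) : Prop :=
  ∃ t, 0 ≤ t ∧ c < f t ∧ ∀ s ∈ Icc 0 t, -c < f s

lemma not_exitsAbove_and_exitsAbove_neg {f : ℝ → ℝ} {c : ℝ} :
    ¬ (ExitsAbove f c ∧ ExitsAbove (-f) c) := by
  rintro ⟨⟨t, ht, hft, hf⟩, ⟨s, hs, hgs, hg⟩⟩
  simp only [Pi.neg_apply] at hgs hg
  rcases le_total t s with h | h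
  · linarith [hg t ⟨ht, h⟩]
  · linarith [hf s ⟨hs, h⟩]

lemma isOpen_setOf_exitsAbove {X : ℝ → ℝ → ℝ} {c : ℝ} (hcont : ∀ ψ, ContinuousOn (X ψ) (Ici 0))
    (hunif : ∀ ψ T, TendstoUniformlyOn X (X ψ) (𝓝 ψ) (Icc 0 T)) :
    IsOpen {ψ | ExitsAbove (X ψ) c} := by
  rw [isOpen_iff_mem_nhds]
  rintro ψ ⟨t, ht, hct, hlow⟩
  obtain ⟨s, hs, hmin⟩ := isCompact_Icc.exists_isMinOn (nonempty_Icc.2 ht)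
    ((hcont ψ).mono Icc_subset_Ici_self)
  have hε : 0 < min (X ψ t - c) (X ψ s + c) :=
    lt_min (by linarith) (by linarith [hlow s hs])
  filter_upwards [Metric.tendstoUniformlyOn_iff.1 (hunif ψ t) _ hε] with ψ' hψ'
  refine ⟨t, ht, ?_, fun r hr => ?_⟩
  · have := (abs_lt.1 (lt_min_iff.1 (hψ' t ⟨ht, le_rfl⟩)).1).2
    linarith
  · have := (abs_lt.1 (lt_min_iff.1 (hψ' r hr)).2).2
    have := hmin hr
    simp only [mem_ofPred_eq] at this
    linarith

/-- Nonnegative velocity and positive acceleration at time `t` force `f` to increase after `t`. -/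
lemma exists_strictMonoOn_Icc {f f' f'' : ℝ → ℝ}
    (hf : ∀ t ∈ Ici (0 : ℝ), HasDerivWithinAt f (f' t) (Ici 0) t)
    (hf' : ∀ t ∈ Ici (0 : ℝ), HasDerivWithinAt f' (f'' t) (Ici 0) t)
    (hf'' : ContinuousOn f'' (Ici 0)) {t : ℝ} (ht : 0 ≤ t) (hv : 0 ≤ f' t) (hpos : 0 < f'' t) :
    ∃ s, t < s ∧ StrictMonoOn f (Icc t s) := by
  have hev : ∀ᶠ s in 𝓝[≥] t, 0 < f'' s :=
    ((hf'' t ht).mono (Ici_subset_Ici.2 ht)).eventually (lt_mem_nhds hpos)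
  obtain ⟨s, hts, hs⟩ := (mem_nhdsGE_iff_exists_Icc_subset).1 hev
  have hsub : Icc t s ⊆ Ici 0 := fun r hr => ht.trans hr.1
  have hderiv : ∀ {g g' : ℝ → ℝ}, (∀ t ∈ Ici (0 : ℝ), HasDerivWithinAt g (g' t) (Ici 0) t) →
      ∀ r ∈ interior (Icc t s), deriv g r = g' r := by
    intro g g' hg r hr
    rw [interior_Icc] at hr
    have hr0 : 0 < r := ht.trans_lt hr.1
    exact ((hg r hr0.le).hasDerivAt (Ici_mem_nhds hr0)).deriv
  have hmono' : StrictMonoOn f' (Icc t s) := strictMonoOn_of_deriv_pos (convex_Icc t s)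
    (fun r hr => ((hf' r (hsub hr)).continuousWithinAt).mono hsub)
    (fun r hr => by rw [hderiv hf' r hr]; exact hs (interior_subset hr))
  refine ⟨s, hts, strictMonoOn_of_deriv_pos (convex_Icc t s)
    (fun r hr => ((hf r (hsub hr)).continuousWithinAt).mono hsub) (fun r hr => ?_)⟩
  rw [hderiv hf r hr]
  rw [interior_Icc] at hr
  exact hv.trans_lt (hmono' ⟨le_rfl, hts.le⟩ ⟨hr.1.le, hr.2.le⟩ hr.1)

lemma nonneg_of_hasDerivWithinAt_of_le_left {f : ℝ → ℝ} {d t : ℝ} (ht : 0 < t)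
    (hf : HasDerivWithinAt f d (Ici 0) t) (hle : ∀ s ∈ Ico 0 t, f s ≤ f t) : 0 ≤ d := by
  have hd : HasDerivWithinAt f d (Iio t) t :=
    (hf.hasDerivAt (Ici_mem_nhds ht)).hasDerivWithinAt
  rw [hasDerivWithinAt_iff_tendsto_slope' (by simp)] at hd
  refine ge_of_tendsto hd ?_
  filter_upwards [Ico_mem_nhdsLT ht] with s hs
  rw [slope_def_field]
  exact div_nonneg_of_nonpos (by linarith [hle s hs]) (by linarith [hs.2])

/-- A trajectory reaching `c` from inside `(-c, c)`, where it is accelerated outwards, exits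
above. -/
lemma exitsAbove_of_eq {f f' f'' : ℝ → ℝ} {c : ℝ} (hc : 0 < c)
    (hf : ∀ t ∈ Ici (0 : ℝ), HasDerivWithinAt f (f' t) (Ici 0) t)
    (hf' : ∀ t ∈ Ici (0 : ℝ), HasDerivWithinAt f' (f'' t) (Ici 0) t)
    (hf'' : ContinuousOn f'' (Ici 0)) (hv₀ : f 0 = c → 0 ≤ f' 0)
    (hpos : ∀ t, 0 ≤ t → f t = c → 0 < f'' t) {t : ℝ} (ht : 0 ≤ t) (htc : f t = c)
    (hbefore : ∀ s ∈ Ico 0 t, |f s| < c) : ExitsAbove f c := by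
  have hv : 0 ≤ f' t := by
    rcases ht.eq_or_lt with rfl | h
    · exact hv₀ htc
    · exact nonneg_of_hasDerivWithinAt_of_le_left h (hf t ht)
        (fun s hs => htc ▸ (abs_lt.1 (hbefore s hs)).2.le)
  obtain ⟨s, hts, hmono⟩ := exists_strictMonoOn_Icc hf hf' hf'' ht hv (hpos t ht htc)
  refine ⟨s, ht.trans hts.le, ?_, fun r hr => ?_⟩
  · exact htc ▸ hmono ⟨le_rfl, hts.le⟩ ⟨hts.le, le_rfl⟩ hts
  · rcases lt_or_ge r t with h | h
    · exact (abs_lt.1 (hbefore r ⟨hr.1, h⟩)).1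
    · have := hmono.monotoneOn ⟨le_rfl, hts.le⟩ ⟨h, hr.2⟩ h
      linarith

/-- A trajectory that starts in `[-c, c]`, is accelerated outwards at `±c`, and exits neither
above nor below stays in `(-c, c)`. -/
lemma abs_lt_of_not_exitsAbove {f f' f'' : ℝ → ℝ} {c : ℝ} (hc : 0 < c)
    (hf : ∀ t ∈ Ici (0 : ℝ), HasDerivWithinAt f (f' t) (Ici 0) t)
    (hf' : ∀ t ∈ Ici (0 : ℝ), HasDerivWithinAt f' (f'' t) (Ici 0) t)
    (hf'' : ContinuousOn f'' (Ici 0)) (h₀ : |f 0| ≤ c)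
    (hv₀ : f 0 = c → 0 ≤ f' 0) (hv₀' : f 0 = -c → f' 0 ≤ 0)
    (hpos : ∀ t, 0 ≤ t → f t = c → 0 < f'' t) (hneg : ∀ t, 0 ≤ t → f t = -c → f'' t < 0)
    (habove : ¬ ExitsAbove f c) (hbelow : ¬ ExitsAbove (-f) c) :
    ∀ t ∈ Ici (0 : ℝ), |f t| < c := by
  by_contra! hex
  have hcont : ContinuousOn (fun t => |f t|) (Ici 0) :=
    fun t ht => (hf t ht).continuousWithinAt.abs
  have hclosed : IsClosed (Ici 0 ∩ (fun t => |f t|) ⁻¹' Ici c) :=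
    hcont.preimage_isClosed_of_isClosed isClosed_Ici isClosed_Ici
  have hbdd : BddBelow (Ici 0 ∩ (fun t => |f t|) ⁻¹' Ici c) := ⟨0, fun s hs => hs.1⟩
  obtain ⟨ht, htc⟩ := hclosed.csInf_mem hex hbdd
  have hmin := fun s hs => csInf_le (a := s) hbdd hs
  generalize sInf (Ici 0 ∩ (fun t => |f t|) ⁻¹' Ici c) = t at ht htc hmin
  rw [mem_Ici] at ht
  have hbefore : ∀ s ∈ Ico 0 t, |f s| < c := fun s hs => by
    by_contra! h
    exact absurd (hmin s ⟨hs.1, h⟩) (not_le.2 hs.2)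
  have hle : |f t| ≤ c := by
    rcases ht.eq_or_lt with rfl | h
    · exact h₀
    · have htend : Tendsto (fun s => |f s|) (𝓝[<] t) (𝓝 |f t|) :=
        (hcont.continuousAt (Ici_mem_nhds h)).mono_left nhdsWithin_le_nhds
      refine le_of_tendsto htend ?_
      filter_upwards [Ico_mem_nhdsLT h] with s hs using (hbefore s hs).le
  rcases eq_or_eq_neg_of_abs_eq (le_antisymm hle htc) with h | h
  · exact habove (exitsAbove_of_eq hc hf hf' hf'' hv₀ hpos ht h hbefore)
  · refine hbelow (exitsAbove_of_eq (f := -f) (f' := -f') (f'' := -f'') hc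
      (fun s hs => (hf s hs).neg) (fun s hs => (hf' s hs).neg) hf''.neg (fun h' => ?_)
      (fun s hs h' => ?_) ht (by simp [h]) (by simpa using hbefore))
    · exact neg_nonneg.2 (hv₀' (neg_eq_iff_eq_neg.1 h'))
    · exact neg_pos.2 (hneg s hs (neg_eq_iff_eq_neg.1 h'))

/-- Shooting: if the family of trajectories starting in `[-c, c]` is accelerated outwards at `±c`
and never starts inwards there, then some member stays in `(-c, c)`. -/
lemma exists_forall_abs_lt_of_shooting {X V A : ℝ → ℝ → ℝ} {c : ℝ} (hc : 0 < c)
    (hX : ∀ ψ, ∀ t ∈ Ici (0 : ℝ), HasDerivWithinAt (X ψ) (V ψ t) (Ici 0) t)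
    (hV : ∀ ψ, ∀ t ∈ Ici (0 : ℝ), HasDerivWithinAt (V ψ) (A ψ t) (Ici 0) t)
    (hA : ∀ ψ, ContinuousOn (A ψ) (Ici 0))
    (hunif : ∀ ψ T, TendstoUniformlyOn X (X ψ) (𝓝 ψ) (Icc 0 T))
    (h₀ : ∀ ψ, X ψ 0 = ψ) (hvc : 0 ≤ V c 0) (hvc' : V (-c) 0 ≤ 0)
    (hpos : ∀ ψ t, 0 ≤ t → X ψ t = c → 0 < A ψ t)
    (hneg : ∀ ψ t, 0 ≤ t → X ψ t = -c → A ψ t < 0) :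
    ∃ ψ, ∀ t ∈ Ici (0 : ℝ), |X ψ t| < c := by
  have hcont : ∀ ψ, ContinuousOn (X ψ) (Ici 0) := fun ψ t ht => (hX ψ t ht).continuousWithinAt
  have hopen : IsOpen {ψ | ExitsAbove (X ψ) c} := isOpen_setOf_exitsAbove hcont hunif
  have hopen' : IsOpen {ψ | ExitsAbove (-X ψ) c} :=
    isOpen_setOf_exitsAbove (X := fun ψ => -X ψ) (fun ψ => (hcont ψ).neg) fun ψ T => by
      have := hunif ψ T
      rw [Metric.tendstoUniformlyOn_iff] at this ⊢
      simpa only [Pi.neg_apply, dist_neg_neg] using this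
  have hmem : ExitsAbove (X c) c :=
    exitsAbove_of_eq hc (hX c) (hV c) (hA c) (fun _ => hvc) (hpos c) le_rfl (h₀ c) (by simp)
  have hmem' : ExitsAbove (-X (-c)) c :=
    exitsAbove_of_eq (f' := -V (-c)) (f'' := -A (-c)) hc
      (fun s hs => (hX _ s hs).neg) (fun s hs => (hV _ s hs).neg) (hA _).neg
      (fun _ => neg_nonneg.2 hvc')
      (fun s hs h => neg_pos.2 (hneg _ s hs (neg_eq_iff_eq_neg.1 h))) le_rfl
      (by simp [h₀]) (by simp)
  obtain ⟨ψ, hψ, habove, hbelow⟩ : ∃ ψ ∈ Icc (-c) c,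
      ¬ ExitsAbove (X ψ) c ∧ ¬ ExitsAbove (-X ψ) c := by
    by_contra! hcover
    obtain ⟨ψ, -, h⟩ := isPreconnected_Icc _ _ hopen hopen'
      (fun ψ hψ => or_iff_not_imp_left.2 (hcover ψ hψ))
      ⟨c, ⟨by linarith, le_rfl⟩, hmem⟩ ⟨-c, ⟨le_rfl, by linarith⟩, hmem'⟩
    exact not_exitsAbove_and_exitsAbove_neg h
  refine ⟨ψ, abs_lt_of_not_exitsAbove hc (hX ψ) (hV ψ) (hA ψ) ?_ ?_ ?_ (hpos ψ) (hneg ψ)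
    habove hbelow⟩
  · rw [h₀]
    exact abs_le.2 hψ
  · rw [h₀]
    rintro rfl
    exact hvc
  · rw [h₀]
    rintro rfl
    exact hvc'

lemma contDiffOn_succ_of_hasDerivWithinAt {f f' : ℝ → ℝ} {s : Set ℝ} (hs : UniqueDiffOn ℝ s)
    {n : ℕ} (hf : ∀ t ∈ s, HasDerivWithinAt f (f' t) s t) (hf' : ContDiffOn ℝ n f' s) :
    ContDiffOn ℝ (n + 1) f s := by
  rw [contDiffOn_succ_iff_derivWithin hs]
  exact ⟨fun t ht => (hf t ht).differentiableWithinAt, by simp,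
    hf'.congr fun t ht => (hf t ht).derivWithin (hs t ht)⟩

lemma contDiffOn_four_of_pendulum {a x y : ℝ → ℝ} {s : Set ℝ} (hs : UniqueDiffOn ℝ s)
    (ha : ContDiffOn ℝ 2 a s) (hx : ∀ t ∈ s, HasDerivWithinAt x (y t) s t)
    (hy : ∀ t ∈ s, HasDerivWithinAt y (sin (x t) - a t * cos (x t)) s t) :
    ContDiffOn ℝ 4 x s := by
  have step : ∀ n : ℕ, n ≤ 2 → ContDiffOn ℝ n x s → ContDiffOn ℝ (n + 2 : ℕ) x s := by
    intro n hn h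
    have hforce : ContDiffOn ℝ n (fun t => sin (x t) - a t * cos (x t)) s :=
      h.sin.sub ((ha.of_le (by exact_mod_cast hn)).mul h.cos)
    have hy' := contDiffOn_succ_of_hasDerivWithinAt hs hy hforce
    exact_mod_cast contDiffOn_succ_of_hasDerivWithinAt (n := n + 1) hs hx (by exact_mod_cast hy')
  have h₀ : ContDiffOn ℝ (0 : ℕ) x s :=
    contDiffOn_zero.2 fun t ht => (hx t ht).continuousWithinAt
  exact_mod_cast step 2 le_rfl (step 0 (by norm_num) h₀)

/-- If the acceleration of the train is bounded, `|ẅ(t)| < C`, and `φ₀ ∈ (0, π/2)`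
is the root of `tan φ₀ = C`, then for every `λ ∈ ℝ` the Whitney pendulum has a
solution with `φ(0) = ψ ∈ (−φ₀, φ₀)`, `φ̇(0) = λ(φ₀² − ψ²)`, staying in
`|φ(t)| < φ₀` for all `t ≥ 0`. -/
theorem whitney_pendulum_bounded_acceleration (w : ℝ → ℝ) (hw : ContDiffOn ℝ 4 w (Ici 0))
    (C : ℝ) (hC : 0 < C)
    (hbdd : ∀ t ∈ Ici (0:ℝ), |iteratedDerivWithin 2 w (Ici 0) t| < C)
    (φ₀ : ℝ) (hφ₀ : φ₀ ∈ Ioo 0 (π/2)) (hφ₀C : Real.tan φ₀ = C) (lam : ℝ) :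
    ∃ ψ ∈ Ioo (-φ₀) φ₀, ∃ φ φ' : ℝ → ℝ,
      (∀ t ∈ Ici (0:ℝ), HasDerivWithinAt φ (φ' t) (Ici 0) t ∧
        HasDerivWithinAt φ'
          (Real.sin (φ t) - iteratedDerivWithin 2 w (Ici 0) t * Real.cos (φ t)) (Ici 0) t) ∧
      ContDiffOn ℝ 4 φ (Ici 0) ∧
      φ 0 = ψ ∧ φ' 0 = lam * (φ₀^2 - ψ^2) ∧
      ∀ t ∈ Ici (0:ℝ), |φ t| < φ₀ := by
  have hud : UniqueDiffOn ℝ (Ici (0 : ℝ)) := uniqueDiffOn_Ici 0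
  set b := iteratedDerivWithin 2 w (Ici 0) with hb
  have hb2 : ContDiffOn ℝ 2 b (Ici 0) := by
    have h1 : ContDiffOn ℝ 3 (derivWithin w (Ici 0)) (Ici 0) :=
      hw.derivWithin hud (by norm_num)
    have h2 : ContDiffOn ℝ 2 (derivWithin (derivWithin w (Ici 0)) (Ici 0)) (Ici 0) :=
      h1.derivWithin hud (by norm_num)
    refine h2.congr fun t ht => ?_
    rw [hb, iteratedDerivWithin_succ]
    exact derivWithin_congr (fun s hs => by rw [iteratedDerivWithin_one])
      (by rw [iteratedDerivWithin_one])
  set a : ℝ → ℝ := fun t => b (max 0 t) with ha_def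
  have hab : ∀ t ∈ Ici (0 : ℝ), a t = b t := fun t ht => by rw [ha_def]; simp [mem_Ici.1 ht]
  have hac : Continuous a :=
    hb2.continuousOn.comp_continuous (by fun_prop) fun t => mem_Ici.2 (le_max_left _ _)
  have ha : ∀ t, |a t| < C := fun t => hbdd _ (mem_Ici.2 (le_max_left _ _))
  lift C to ℝ≥0 using hC.le
  have hlip := lipschitzWith_pendulumField fun t => (ha t).le
  have hsol (ψ : ℝ) := exists_solution_Ici hlip fun T hT =>
    exists_pendulum_solution_Icc hac (fun t => (ha t).le) (ψ, lam * (φ₀ ^ 2 - ψ ^ 2)) hT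
  choose γ hγ₀ hγ using hsol
  have hX : ∀ ψ, ∀ t ∈ Ici (0 : ℝ),
      HasDerivWithinAt (fun t => (γ ψ t).1) (γ ψ t).2 (Ici 0) t := fun ψ t ht => (hγ ψ t ht).fst
  have hV : ∀ ψ, ∀ t ∈ Ici (0 : ℝ), HasDerivWithinAt (fun t => (γ ψ t).2)
      (sin (γ ψ t).1 - a t * cos (γ ψ t).1) (Ici 0) t := fun ψ t ht => (hγ ψ t ht).snd
  have hcos : 0 < cos φ₀ := cos_pos_of_mem_Ioo ⟨by linarith [hφ₀.1, pi_pos], hφ₀.2⟩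
  have hsin : sin φ₀ = C * cos φ₀ := by rw [← hφ₀C, tan_mul_cos hcos.ne']
  obtain ⟨ψ, hψ⟩ := exists_forall_abs_lt_of_shooting hφ₀.1 hX hV
    (fun ψ => by
      have hc : ContinuousOn (fun t => (γ ψ t).1) (Ici 0) :=
        fun t ht => (hX ψ t ht).continuousWithinAt
      exact (continuous_sin.comp_continuousOn hc).sub
        (hac.continuousOn.mul (continuous_cos.comp_continuousOn hc)))
    (fun ψ T => by
      rw [Metric.tendstoUniformlyOn_iff]
      intro ε hε
      have htend : Tendsto (fun ψ' => dist (γ ψ 0) (γ ψ' 0) * exp ((1 + C : ℝ≥0) * T)) (𝓝 ψ)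
          (𝓝 0) := by
        simp only [hγ₀]
        exact (show Continuous fun ψ' : ℝ => dist (ψ, lam * (φ₀ ^ 2 - ψ ^ 2))
          (ψ', lam * (φ₀ ^ 2 - ψ' ^ 2)) * exp ((1 + C : ℝ≥0) * T) by fun_prop).tendsto' _ _
            (by simp)
      filter_upwards [htend.eventually (gt_mem_nhds hε)] with ψ' hψ' t ht
      have hle := dist_solution_le hlip
        (fun s hs => (hγ ψ s hs.1).mono Icc_subset_Ici_self)
        (fun s hs => (hγ ψ' s hs.1).mono Icc_subset_Ici_self) t ht
      calc dist (γ ψ t).1 (γ ψ' t).1 ≤ dist (γ ψ t) (γ ψ' t) := le_max_left _ _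
        _ ≤ dist (γ ψ 0) (γ ψ' 0) * exp ((1 + C : ℝ≥0) * t) := hle
        _ ≤ dist (γ ψ 0) (γ ψ' 0) * exp ((1 + C : ℝ≥0) * T) := by gcongr; exact ht.2
        _ < ε := hψ')
    (fun ψ => by simp [hγ₀]) (by simp [hγ₀]) (by simp [hγ₀])
    (fun ψ t ht h => by
      rw [h, hsin]
      nlinarith [(abs_lt.1 (ha t)).2])
    (fun ψ t ht h => by
      rw [h, sin_neg, cos_neg, hsin]
      nlinarith [(abs_lt.1 (ha t)).1])
  have hode : ∀ t ∈ Ici (0 : ℝ), HasDerivWithinAt (fun t => (γ ψ t).2)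
      (sin (γ ψ t).1 - b t * cos (γ ψ t).1) (Ici 0) t := fun t ht => hab t ht ▸ hV ψ t ht
  refine ⟨ψ, ?_, fun t => (γ ψ t).1, fun t => (γ ψ t).2, fun t ht => ⟨hX ψ t ht, hode t ht⟩,
    contDiffOn_four_of_pendulum hud hb2 (hX ψ) hode, by simp [hγ₀], by simp [hγ₀], hψ⟩
  simpa [hγ₀] using abs_lt.1 (hψ 0 self_mem_Ici)
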